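/- Let k be a positive integer, α a real number, and x₁,…,x_k real numbers satisfying, for every j ∈ {1,…,k}, Σ_{ℓ=1}^{j−1} x_ℓ + (k−j+1)·x_j ≤ α·k + j. Then for every j* ∈ {1,…,k−1}: Σ_{j=1}^{j*} x_j ≤ (k−j*) · Σ_{j=1}^{j*} (α·k + j) / ((k−j)(k−j+1)). -/

import Mathlib

/-- **Weighted-sum telescoping bound.**
If for every `j ∈ {1,…,k}` we have `∑_{ℓ<j} x_ℓ + (k−j+1)·x_j ≤ α·k + j`, then for
every `j* ∈ {1,…,k−1}`:
`∑_{j=1}^{j*} x_j ≤ (k−j*) · ∑_{j=1}^{j*} (α·k + j)/((k−j)(k−j+1))`. -/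
theorem weighted_prefix_bound
    (k : ℕ) (hk : 0 < k) (α : ℝ) (x : ℕ → ℝ)
    (hyp : ∀ j ∈ Finset.Icc 1 k,
      (∑ ℓ ∈ Finset.Icc 1 (j - 1), x ℓ) + ((k:ℝ) - j + 1) * x j ≤ α * k + j) :
    ∀ js ∈ Finset.Icc 1 (k - 1),
      ∑ j ∈ Finset.Icc 1 js, x j ≤
        ((k:ℝ) - js) * ∑ j ∈ Finset.Icc 1 js,
          (α * k + j) / (((k:ℝ) - j) * ((k:ℝ) - j + 1)) := by
  suffices h : ∀ n : ℕ, n < k → ∑ j ∈ Finset.Icc 1 n, x j ≤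
      ((k:ℝ) - n) * ∑ j ∈ Finset.Icc 1 n, (α * k + j) / (((k:ℝ) - j) * ((k:ℝ) - j + 1)) by
    intro js hjs
    exact h js (by grind)
  intro n
  induction n with
  | zero => simp
  | succ n ih =>
    intro hn
    have ih := ih (by omega)
    have step := hyp (n + 1) (by grind)
    rw [Finset.sum_Icc_succ_top (by omega), Finset.sum_Icc_succ_top (by omega)]
    rw [Nat.add_sub_cancel] at step
    have hd : (0:ℝ) < k - (n + 1 : ℕ) := sub_pos.mpr (by exact_mod_cast hn)
    have hdn : (k:ℝ) - n = k - (n + 1 : ℕ) + 1 := by push_cast; ring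
    rw [hdn] at ih
    generalize (k:ℝ) - (n + 1 : ℕ) = d at *
    generalize α * k + (n + 1 : ℕ) = c at *
    generalize ∑ j ∈ Finset.Icc 1 n, x j = S at *
    generalize ∑ j ∈ Finset.Icc 1 n, (α * k + j) / (((k:ℝ) - j) * ((k:ℝ) - j + 1)) = T at *
    have hc : d * (T + c / (d * (d + 1))) = (d * (d + 1) * T + c) / (d + 1) := by
      field_simp
    rw [hc, le_div_iff₀ (by positivity)]
    nlinarith [mul_le_mul_of_nonneg_left ih hd.le]
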